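/- Let Z = ℝ^p × ℝ^q with the Euclidean product norm. Let H : Z → L(ℝ^q, ℝ^q) take self-adjoint values with μ‖u‖² ≤ ⟨H(z)u, u⟩ and ‖H(z)u‖ ≤ L_g‖u‖ for all z ∈ Z and u ∈ ℝ^q (with 0 < μ ≤ L_g, so each H(z) is invertible), and ‖H(z₁) − H(z₂)‖ ≤ L_gyy ‖z₁ − z₂‖ in operator norm; let b : Z → ℝ^q be L_fy-Lipschitz with ‖b(z)‖² ≤ C_fy for all z, and set v*(z) := H(z)⁻¹ b(z). Let r_v ≥ √C_fy/μ. Fix z = (x,y) ∈ Z, vectors h_f ∈ ℝ^p, h_g, h_R, v ∈ ℝ^q, stepsizes α, β, λ > 0 and any γ, δ > 0; set x' = x − α h_f, y' = y − β h_g, z' = (x', y'), w := v − λ h_R, v' := w if ‖w‖ ≤ r_v and v' := r_v w/‖w‖ otherwise, and e_R := h_R − (H(z) v − b(z)). Then ‖v' − v*(z')‖² ≤ (1+γ)(1+δ)[(1 − 2λ μ L_g/(μ + L_g)) ‖v − v*(z)‖² − (2λ/(μ + L_g) − λ²) ‖H(z)v − b(z)‖²] + (1+γ)(1 + 1/δ)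 λ² ‖e_R‖² + (1 + 1/γ)(2 L_fy²/μ² + 2 C_fy L_gyy²/μ⁴)(α² ‖h_f‖² + β² ‖h_g‖²). -/

import Mathlib

open scoped RealInnerProductSpace

abbrev E (n : ℕ) := EuclideanSpace ℝ (Fin n)

abbrev Z (p q : ℕ) := WithLp 2 (E p × E q)

noncomputable def zmk {p q : ℕ} (x : E p) (y : E q) : Z p q :=
  (WithLp.equiv 2 (E p × E q)).symm (x, y)

/-- The weighted Young inequality for the squared norm of a sum. -/
theorem norm_add_sq_le_young {F : Type*} [SeminormedAddCommGroup F] (a b : F) {γ : ℝ} (hγ : 0 < γ) :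
    ‖a + b‖ ^ 2 ≤ (1 + γ) * ‖a‖ ^ 2 + (1 + 1 / γ) * ‖b‖ ^ 2 := by
  have h1 : ‖a + b‖ ^ 2 ≤ (‖a‖ + ‖b‖) ^ 2 := by
    gcongr
    exact norm_add_le a b
  have h2 : (1 + γ) * ‖a‖ ^ 2 + (1 + 1 / γ) * ‖b‖ ^ 2 - (‖a‖ + ‖b‖) ^ 2
      = (γ * ‖a‖ - ‖b‖) ^ 2 / γ := by
    field_simp
    ring
  have h3 : 0 ≤ (γ * ‖a‖ - ‖b‖) ^ 2 / γ := by positivity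
  linarith

section

variable {F : Type*} [NormedAddCommGroup F] [InnerProductSpace ℝ F]

/-- A symmetric operator `P` with `0 ≤ P ≤ c` is `1 / c`-cocoercive. -/
theorem norm_sq_le_mul_inner_of_symm (P : F →L[ℝ] F) {c : ℝ} (hc : 0 ≤ c)
    (hsymm : ∀ u w : F, ⟪P u, w⟫ = ⟪u, P w⟫) (hpos : ∀ u : F, 0 ≤ ⟪P u, u⟫)
    (hle : ∀ u : F, ⟪P u, u⟫ ≤ c * ‖u‖ ^ 2) (u : F) :
    ‖P u‖ ^ 2 ≤ c * ⟪P u, u⟫ := by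
  have key (t : ℝ) : 0 ≤ ⟪P u, u⟫ - 2 * t * ‖P u‖ ^ 2 + t ^ 2 * ⟪P (P u), P u⟫ := by
    have h := hpos (u - t • P u)
    have h' : ⟪P (P u), u⟫ = ‖P u‖ ^ 2 := by rw [hsymm, real_inner_self_eq_norm_sq]
    simp only [map_sub, map_smul, inner_sub_left, inner_sub_right, real_inner_smul_left,
      real_inner_smul_right, h', real_inner_self_eq_norm_sq] at h
    linarith
  have hPP := hle (P u)
  rcases hc.eq_or_lt with rfl | hc
  · have h := key 1
    have h' := hle u
    nlinarith
  · have h := key (1 / c)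
    have h1 : (1 / c) ^ 2 * ⟪P (P u), P u⟫ ≤ (1 / c) ^ 2 * (c * ‖P u‖ ^ 2) := by gcongr
    have h2 : (1 / c) ^ 2 * (c * ‖P u‖ ^ 2) = ‖P u‖ ^ 2 / c := by field_simp
    have h3 : 2 * (1 / c) * ‖P u‖ ^ 2 = 2 * (‖P u‖ ^ 2 / c) := by ring
    have h4 : ‖P u‖ ^ 2 / c ≤ ⟪P u, u⟫ := by linarith
    rw [div_le_iff₀ hc] at h4
    linarith

/-- Co-coercivity of a symmetric operator with spectrum in `[μ, L]`. -/
theorem add_norm_sq_le_mul_inner_of_symm (A : F →L[ℝ] F) {μ L : ℝ} (hμL : μ ≤ L)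
    (hsymm : ∀ u w : F, ⟪A u, w⟫ = ⟪u, A w⟫) (hcoer : ∀ u : F, μ * ‖u‖ ^ 2 ≤ ⟪A u, u⟫)
    (hbd : ∀ u : F, ‖A u‖ ≤ L * ‖u‖) (u : F) :
    μ * L * ‖u‖ ^ 2 + ‖A u‖ ^ 2 ≤ (μ + L) * ⟪A u, u⟫ := by
  have happ (u : F) : (A - μ • ContinuousLinearMap.id ℝ F) u = A u - μ • u := by simp
  have h := norm_sq_le_mul_inner_of_symm (A - μ • ContinuousLinearMap.id ℝ F)
    (sub_nonneg.2 hμL) ?_ ?_ ?_ u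
  · rw [happ, norm_sub_sq_real, inner_sub_left, real_inner_smul_left, real_inner_smul_right,
      norm_smul, mul_pow, Real.norm_eq_abs, sq_abs, real_inner_self_eq_norm_sq] at h
    linarith
  · intro u w
    simp only [happ, inner_sub_left, inner_sub_right, real_inner_smul_left,
      real_inner_smul_right, hsymm]
  · intro u
    rw [happ, inner_sub_left, real_inner_smul_left, real_inner_self_eq_norm_sq]
    linarith [hcoer u]
  · intro u
    rw [happ, inner_sub_left, real_inner_smul_left, real_inner_self_eq_norm_sq]
    have h1 := real_inner_le_norm (A u) u
    have h2 := mul_le_mul_of_nonneg_right (hbd u) (norm_nonneg u)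
    linarith

/-- Contraction of a gradient step for a symmetric operator with spectrum in `[μ, L]`. -/
theorem norm_sub_smul_sq_le_of_symm (A : F →L[ℝ] F) {μ L : ℝ} (hμ : 0 < μ) (hμL : μ ≤ L)
    (hsymm : ∀ u w : F, ⟪A u, w⟫ = ⟪u, A w⟫) (hcoer : ∀ u : F, μ * ‖u‖ ^ 2 ≤ ⟪A u, u⟫)
    (hbd : ∀ u : F, ‖A u‖ ≤ L * ‖u‖) {t : ℝ} (ht : 0 ≤ t) (u : F) :
    ‖u - t • A u‖ ^ 2 ≤ (1 - 2 * t * μ * L / (μ + L)) * ‖u‖ ^ 2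
      - (2 * t / (μ + L) - t ^ 2) * ‖A u‖ ^ 2 := by
  have hpos : 0 < μ + L := by linarith
  have h := add_norm_sq_le_mul_inner_of_symm A hμL hsymm hcoer hbd u
  rw [← div_le_iff₀' hpos] at h
  have h1 := mul_le_mul_of_nonneg_left h (mul_nonneg zero_le_two ht)
  rw [norm_sub_sq_real, real_inner_smul_right, norm_smul, mul_pow, Real.norm_eq_abs, sq_abs,
    real_inner_comm]
  have h2 : 2 * t * ((μ * L * ‖u‖ ^ 2 + ‖A u‖ ^ 2) / (μ + L))
      = 2 * t * μ * L / (μ + L) * ‖u‖ ^ 2 + 2 * t / (μ + L) * ‖A u‖ ^ 2 := by ring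
  linarith

/-- A coercive operator is bounded below. -/
theorem mul_norm_le_norm_of_coercive (A : F →L[ℝ] F) {μ : ℝ}
    (hcoer : ∀ u : F, μ * ‖u‖ ^ 2 ≤ ⟪A u, u⟫) (u : F) : μ * ‖u‖ ≤ ‖A u‖ := by
  rcases (norm_nonneg u).eq_or_lt with h | h
  · simp [← h]
  · have h1 := (hcoer u).trans (real_inner_le_norm (A u) u)
    refine le_of_mul_le_mul_right ?_ h
    linarith

/-- Projecting radially onto the ball of radius `r` does not increase the distance to points of
that ball. -/
theorem norm_radial_proj_sub_le {w s : F} {r : ℝ} (hs : ‖s‖ ≤ r) :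
    ‖(if ‖w‖ ≤ r then w else (r / ‖w‖) • w) - s‖ ≤ ‖w - s‖ := by
  split_ifs with hw
  · exact le_rfl
  · push Not at hw
    have hr : 0 ≤ r := (norm_nonneg s).trans hs
    have hw0 : 0 < ‖w‖ := hr.trans_lt hw
    have hin : ⟪w, s⟫ ≤ ‖w‖ * r :=
      (real_inner_le_norm w s).trans (mul_le_mul_of_nonneg_left hs hw0.le)
    obtain ⟨t, ht⟩ : ∃ t, t = r / ‖w‖ := ⟨_, rfl⟩
    have hrt : r = t * ‖w‖ := by rw [ht]; field_simp
    have ht1 : t ≤ 1 := by rw [ht, div_le_one hw0]; exact hw.le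
    rw [← ht]
    refine le_of_sq_le_sq ?_ (norm_nonneg _)
    rw [norm_sub_sq_real, norm_sub_sq_real, real_inner_smul_left, norm_smul, mul_pow,
      Real.norm_eq_abs, sq_abs]
    rw [hrt] at hin
    have h1 := mul_le_mul_of_nonneg_left hin (sub_nonneg.2 ht1)
    have h2 : 0 ≤ (1 - t) ^ 2 * ‖w‖ ^ 2 := by positivity
    nlinarith

/-- Stability of the solution of a coercive linear system under perturbation of the operator and
of the right-hand side. -/
theorem norm_solution_sub_sq_le {A A' : F →L[ℝ] F} {s s' : F} {μ C M K d : ℝ} (hμ : 0 < μ)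
    (hcoer : ∀ u : F, μ * ‖u‖ ^ 2 ≤ ⟪A u, u⟫) (hcoer' : ∀ u : F, μ * ‖u‖ ^ 2 ≤ ⟪A' u, u⟫)
    (hC : ‖A s‖ ^ 2 ≤ C) (hA : ‖A - A'‖ ≤ M * d) (hb : ‖A s - A' s'‖ ≤ K * d) :
    ‖s - s'‖ ^ 2 ≤ (2 * K ^ 2 / μ ^ 2 + 2 * C * M ^ 2 / μ ^ 4) * d ^ 2 := by
  have hs : (μ * ‖s‖) ^ 2 ≤ C :=
    (pow_le_pow_left₀ (by positivity) (mul_norm_le_norm_of_coercive A hcoer s) 2).trans hC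
  have h1 := mul_norm_le_norm_of_coercive A' hcoer' (s - s')
  have h2 : A' (s - s') = (A s - A' s') - (A - A') s := by
    simp
  have h3 : ‖(A - A') s‖ ≤ M * d * ‖s‖ :=
    ((A - A').le_opNorm s).trans (mul_le_mul_of_nonneg_right hA (norm_nonneg s))
  have h4 : μ * ‖s - s'‖ ≤ K * d + M * d * ‖s‖ := by
    rw [h2] at h1
    linarith [norm_sub_le (A s - A' s') ((A - A') s)]
  have h5 : (μ * ‖s - s'‖) ^ 2 ≤ 2 * (K * d) ^ 2 + 2 * (M * d * ‖s‖) ^ 2 :=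
    (pow_le_pow_left₀ (by positivity) h4 2).trans (by nlinarith [sq_nonneg (K * d - M * d * ‖s‖)])
  have h6 : ‖s‖ ^ 2 ≤ C / μ ^ 2 := by
    rw [le_div_iff₀ (by positivity)]
    linarith
  have h7 : (M * d) ^ 2 * ‖s‖ ^ 2 ≤ (M * d) ^ 2 * (C / μ ^ 2) := by gcongr
  have h8 : (2 * K ^ 2 / μ ^ 2 + 2 * C * M ^ 2 / μ ^ 4) * d ^ 2
      = (2 * (K * d) ^ 2 + 2 * ((M * d) ^ 2 * (C / μ ^ 2))) / μ ^ 2 := by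
    field_simp
  rw [h8, le_div_iff₀ (by positivity)]
  linarith

end

theorem norm_zmk_sub_zmk_sq {p q : ℕ} (x h : E p) (y k : E q) (α β : ℝ) :
    ‖zmk x y - zmk (x - α • h) (y - β • k)‖ ^ 2
      = α ^ 2 * ‖h‖ ^ 2 + β ^ 2 * ‖k‖ ^ 2 := by
  rw [WithLp.prod_norm_sq_eq_of_L2]
  simp [zmk, norm_smul, mul_pow]

/-- Descent lemma for the iterates of the linear-system problem
(Proposition 3.3, intermediate form): `H(z)` is self-adjoint with spectrum in
`[μ, L_g]`, `b` is Lipschitz and bounded, `v*(z) = H(z)⁻¹ b(z)`, and the update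
is a gradient step `w = v - λ h_R` followed by projection onto the ball of
radius `r_v ≥ √C_fy / μ`. -/
theorem descent_ls_iterates {p q : ℕ} (hp : 1 ≤ p) (hq : 1 ≤ q)
    (H : Z p q → (E q →L[ℝ] E q)) (b : Z p q → E q) (vstar : Z p q → E q)
    (μ L_g L_gyy L_fy C_fy r_v : ℝ) (hμ : 0 < μ) (hμLg : μ ≤ L_g)
    (hsa : ∀ (z : Z p q) (u w : E q), ⟪H z u, w⟫ = ⟪u, H z w⟫)
    (hcoer : ∀ (z : Z p q) (u : E q), μ * ‖u‖ ^ 2 ≤ ⟪H z u, u⟫)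
    (hbd : ∀ (z : Z p q) (u : E q), ‖H z u‖ ≤ L_g * ‖u‖)
    (hHlip : ∀ z₁ z₂ : Z p q, ‖H z₁ - H z₂‖ ≤ L_gyy * ‖z₁ - z₂‖)
    (hblip : ∀ z₁ z₂ : Z p q, ‖b z₁ - b z₂‖ ≤ L_fy * ‖z₁ - z₂‖)
    (hbbd : ∀ z : Z p q, ‖b z‖ ^ 2 ≤ C_fy)
    (hvstar : ∀ z, H z (vstar z) = b z)
    (hrv : Real.sqrt C_fy / μ ≤ r_v)
    (x h_f : E p) (y h_g : E q) (h_R v : E q) (α β lam γ δ : ℝ)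
    (hα : 0 < α) (hβ : 0 < β) (hlam : 0 < lam) (hγ : 0 < γ) (hδ : 0 < δ) :
    let z := zmk x y
    let z' := zmk (x - α • h_f) (y - β • h_g)
    let w := v - lam • h_R
    let v' := if ‖w‖ ≤ r_v then w else (r_v / ‖w‖) • w
    let e_R := h_R - (H z v - b z)
    ‖v' - vstar z'‖ ^ 2
      ≤ (1 + γ) * (1 + δ) *
          ((1 - 2 * lam * μ * L_g / (μ + L_g)) * ‖v - vstar z‖ ^ 2
            - (2 * lam / (μ + L_g) - lam ^ 2) * ‖H z v - b z‖ ^ 2)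
        + (1 + γ) * (1 + 1 / δ) * lam ^ 2 * ‖e_R‖ ^ 2
        + (1 + 1 / γ) * (2 * L_fy ^ 2 / μ ^ 2 + 2 * C_fy * L_gyy ^ 2 / μ ^ 4)
            * (α ^ 2 * ‖h_f‖ ^ 2 + β ^ 2 * ‖h_g‖ ^ 2) := by
  intro z z' w v' e_R
  have hsmall : ‖vstar z'‖ ≤ r_v := by
    refine le_trans ?_ hrv
    rw [le_div_iff₀' hμ]
    refine (mul_norm_le_norm_of_coercive (H z') (hcoer z') _).trans ?_
    rw [hvstar]
    exact Real.le_sqrt_of_sq_le (hbbd z')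
  have hproj : ‖v' - vstar z'‖ ^ 2 ≤ ‖w - vstar z'‖ ^ 2 :=
    pow_le_pow_left₀ (norm_nonneg _) (norm_radial_proj_sub_le hsmall) 2
  have hres : H z (v - vstar z) = H z v - b z := by rw [map_sub, hvstar]
  have hstep := norm_sub_smul_sq_le_of_symm (H z) hμ hμLg (hsa z) (hcoer z) (hbd z) hlam.le
    (v - vstar z)
  have hdrift := norm_solution_sub_sq_le (s := vstar z) (s' := vstar z') (C := C_fy) hμ
    (hcoer z) (hcoer z') (by rw [hvstar]; exact hbbd z) (hHlip z z')
    (by rw [hvstar, hvstar]; exact hblip z z')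
  rw [norm_zmk_sub_zmk_sq] at hdrift
  rw [hres] at hstep
  have hsplit : w - vstar z'
      = ((v - vstar z - lam • (H z v - b z)) + (-lam) • e_R) + (vstar z - vstar z') := by
    simp only [w, e_R]
    module
  have hy1 := norm_add_sq_le_young ((v - vstar z - lam • (H z v - b z)) + (-lam) • e_R)
    (vstar z - vstar z') hγ
  have hy2 := norm_add_sq_le_young (v - vstar z - lam • (H z v - b z)) ((-lam) • e_R) hδ
  rw [norm_smul, mul_pow, Real.norm_eq_abs, sq_abs, neg_sq] at hy2
  rw [← hsplit] at hy1
  have h1 := hy2.trans (add_le_add_left (mul_le_mul_of_nonneg_left hstep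
    (by positivity : 0 ≤ 1 + δ)) _)
  have h2 := mul_le_mul_of_nonneg_left h1 (by positivity : 0 ≤ 1 + γ)
  have h3 := mul_le_mul_of_nonneg_left hdrift (by positivity : 0 ≤ 1 + 1 / γ)
  linarith
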